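/- arXiv:1310.1649 — 9 statements merged into one kernel-verified Lean document; each statement's English description precedes it below -/
import Mathlib

section
/- For every list of columns s : List (Fin n), the ranking vector for s is unique: if L and L' are both ranking vectors for s, then L = L', and both are equal to the rank function rk_s. -/
open scoped Classical

noncomputable def key {m n : ℕ} (D : Fin m → Fin n → ℝ) (s : List (Fin n)) (j : Fin m) :
    List ℝ := s.map (fun a => D j a)

noncomputable def rk {m n : ℕ} (D : Fin m → Fin n → ℝ) (s : List (Fin n)) (j : Fin m) : ℕ :=
  ((Finset.univ.image (key D s)).filter (fun v => List.Lex (· < ·) v (key D s j))).card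

/-- `L` is a ranking vector for the sequence of columns `s`:
(i) bounded by `m - 1`, (ii) equal keys get equal ranks,
(iii) lexicographically smaller keys get strictly smaller ranks, and
(iv) `∑ j, L j` is minimal among all functions satisfying (i)–(iii). -/
def IsRankingVector {m n : ℕ} (D : Fin m → Fin n → ℝ) (s : List (Fin n))
    (L : Fin m → ℕ) : Prop :=
  (∀ j, L j ≤ m - 1) ∧
  (∀ j k, key D s j = key D s k → L j = L k) ∧
  (∀ j k, List.Lex (· < ·) (key D s j) (key D s k) → L j < L k) ∧
  (∀ L' : Fin m → ℕ,
      (∀ j, L' j ≤ m - 1) →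
      (∀ j k, key D s j = key D s k → L' j = L' k) →
      (∀ j k, List.Lex (· < ·) (key D s j) (key D s k) → L' j < L' k) →
      ∑ j, L j ≤ ∑ j, L' j)

theorem card_image_filter_lt_le {ι α : Type*} [Fintype ι] [LinearOrder α] (f : ι → α)
    (L : ι → ℕ) (hL : ∀ j k, f j < f k → L j < L k) (j : ι) :
    ((Finset.univ.image f).filter (fun v => v < f j)).card ≤ L j := by
  have : Nonempty ι := ⟨j⟩
  have hinv : ∀ v ∈ (Finset.univ.image f).filter (fun v => v < f j),
      f (Function.invFun f v) = v := fun v hv =>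
    Function.invFun_eq (by simpa using (Finset.mem_filter.1 hv).1)
  have hinj : ∀ a b, L a = L b → f a = f b := fun a b hab => by
    rcases lt_trichotomy (f a) (f b) with h | h | h
    · exact absurd hab (hL _ _ h).ne
    · exact h
    · exact absurd hab (hL _ _ h).ne'
  rw [← Finset.card_range (L j)]
  refine Finset.card_le_card_of_injOn (fun v => L (Function.invFun f v)) (fun v hv => ?_)
    (fun v hv w hw hvw => ?_)
  · have h := hL (Function.invFun f v) j
      (by rw [hinv v hv]; exact (Finset.mem_filter.1 hv).2)
    simpa using h
  · rw [← hinv v hv, ← hinv w hw]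
    exact hinj _ _ hvw

theorem card_image_filter_lt_strictMono {ι α : Type*} [Fintype ι] [LinearOrder α] (f : ι → α)
    {j k : ι} (hjk : f j < f k) :
    ((Finset.univ.image f).filter (fun v => v < f j)).card <
      ((Finset.univ.image f).filter (fun v => v < f k)).card := by
  refine Finset.card_lt_card (Finset.ssubset_iff_of_subset ?_ |>.2 ⟨f j, ?_, ?_⟩)
  · exact Finset.monotone_filter_right _ fun v _ hv => lt_trans hv hjk
  · simpa using hjk
  · simp

theorem card_image_filter_lt_lt_card {ι α : Type*} [Fintype ι] [LinearOrder α] (f : ι → α)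
    (j : ι) : ((Finset.univ.image f).filter (fun v => v < f j)).card < Fintype.card ι :=
  (Finset.card_lt_card (Finset.filter_ssubset (p := fun v => v < f j).2
    ⟨f j, Finset.mem_image_of_mem f (Finset.mem_univ j), lt_irrefl _⟩)).trans_le
    Finset.card_image_le

theorem rk_eq_card {m n : ℕ} (D : Fin m → Fin n → ℝ) (s : List (Fin n)) (j : Fin m) :
    rk D s j = ((Finset.univ.image (key D s)).filter (fun v => v < key D s j)).card := by
  unfold rk
  congr!

theorem IsRankingVector.eq_rk {m n : ℕ} {D : Fin m → Fin n → ℝ} {s : List (Fin n)}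
    {L : Fin m → ℕ} (hL : IsRankingVector D s L) : L = rk D s := by
  obtain ⟨-, -, hlt, hmin⟩ := hL
  have hle : ∀ j, rk D s j ≤ L j := fun j => by
    rw [rk_eq_card]
    convert card_image_filter_lt_le (key D s) L hlt j
  have hsum : ∑ j, L j ≤ ∑ j, rk D s j := by
    refine hmin (rk D s) (fun j => ?_) (fun j k h => ?_) (fun j k h => ?_)
    · have hlt_card : rk D s j < Fintype.card (Fin m) := by
        rw [rk_eq_card]
        convert card_image_filter_lt_lt_card (key D s) j
      rw [Fintype.card_fin] at hlt_card
      omega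
    · simp only [rk, h]
    · rw [rk_eq_card, rk_eq_card]
      convert card_image_filter_lt_strictMono (key D s) h
  have heq := (Finset.sum_eq_sum_iff_of_le fun j _ => hle j).1
    (le_antisymm (Finset.sum_le_sum fun j _ => hle j) hsum)
  exact funext fun j => (heq j (Finset.mem_univ j)).symm

theorem rankingVector_unique {m n : ℕ} (hm : 1 ≤ m)
    (D : Fin m → Fin n → ℝ) (s : List (Fin n)) (L L' : Fin m → ℕ)
    (hL : IsRankingVector D s L) (hL' : IsRankingVector D s L') :
    L = L' ∧ L = rk D s ∧ L' = rk D s := by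
  exact ⟨hL.eq_rk.trans hL'.eq_rk.symm, hL.eq_rk, hL'.eq_rk⟩
end

section
/- For every list of columns s : List (Fin n), every column i : Fin n, and all rows j k : Fin m: key_{s++[i]}(j) <lex key_{s++[i]}(k) if and only if rk_s(j) < rk_s(k), or rk_s(j) = rk_s(k) and D j i < D k i; and key_{s++[i]}(j) = key_{s++[i]}(k) if and only if rk_s(j) = rk_s(k) and D j i = D k i. That is, the lexicographic order of rows with respect to the columns s++[i] coincides with the lexicographic order on the pairs (rk_s(j), D j i) in ℕ × ℝ. -/
open scoped Classical

/-- Below-counts in a finite set of a linear order reflect the order of its elements. -/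
theorem Finset.card_filter_lt_lt_card_filter_lt_iff {α : Type*} [LinearOrder α] (S : Finset α)
    {a b : α} (ha : a ∈ S) :
    (S.filter (· < a)).card < (S.filter (· < b)).card ↔ a < b := by
  refine ⟨fun h => ?_, fun h => Finset.card_lt_card ?_⟩
  · by_contra! hba
    exact h.not_ge (Finset.card_le_card
      (Finset.monotone_filter_right S fun x _ hx => lt_of_lt_of_le hx hba))
  · rw [Finset.ssubset_iff_of_subset
      (Finset.monotone_filter_right S fun x _ hx => lt_trans hx h)]
    exact ⟨a, by simp [ha, h], by simp⟩

theorem List.lex_append_singleton_iff {α : Type*} [LinearOrder α] {l₁ l₂ : List α}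
    (h : l₁.length = l₂.length) (a b : α) :
    List.Lex (· < ·) (l₁ ++ [a]) (l₂ ++ [b]) ↔
      List.Lex (· < ·) l₁ l₂ ∨ (l₁ = l₂ ∧ a < b) := by
  induction l₁ generalizing l₂ with
  | nil =>
    obtain rfl : l₂ = [] := List.length_eq_zero_iff.mp h.symm
    simp
  | cons x xs ih =>
    cases l₂ with
    | nil => simp at h
    | cons y ys =>
      have hxy := ih (l₂ := ys) (by simpa using h)
      rcases lt_trichotomy x y with hlt | rfl | hgt
      · exact iff_of_true (.rel hlt) (.inl (.rel hlt))
      · simpa [List.lex_cons_iff] using hxy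
      · refine iff_of_false (fun hl => ?_) ?_
        · cases hl with
          | rel h' => exact h'.not_gt hgt
          | cons _ => exact lt_irrefl _ hgt
        · rintro (hl | ⟨hl, -⟩)
          · cases hl with
            | rel h' => exact h'.not_gt hgt
            | cons _ => exact lt_irrefl _ hgt
          · exact hgt.ne' (List.cons.inj hl).1

theorem rk_lt_rk_iff {m n : ℕ} (D : Fin m → Fin n → ℝ) (s : List (Fin n)) (j k : Fin m) :
    rk D s j < rk D s k ↔ List.Lex (· < ·) (key D s j) (key D s k) := by
  have h := Finset.card_filter_lt_lt_card_filter_lt_iff (Finset.univ.image (key D s))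
    (b := key D s k) (Finset.mem_image_of_mem _ (Finset.mem_univ j))
  unfold rk
  convert h using 2 <;> congr!

theorem rk_eq_rk_iff {m n : ℕ} (D : Fin m → Fin n → ℝ) (s : List (Fin n)) (j k : Fin m) :
    rk D s j = rk D s k ↔ key D s j = key D s k := by
  refine ⟨fun h => ?_, fun h => by simp only [rk, h]⟩
  have hjk : ¬ key D s j < key D s k := fun hl => ((rk_lt_rk_iff D s j k).2 hl).ne h
  have hkj : ¬ key D s k < key D s j := fun hl => ((rk_lt_rk_iff D s k j).2 hl).ne' h
  exact le_antisymm (not_lt.1 hkj) (not_lt.1 hjk)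

theorem key_append_singleton {m n : ℕ} (D : Fin m → Fin n → ℝ) (s : List (Fin n)) (i : Fin n)
    (j : Fin m) : key D (s ++ [i]) j = key D s j ++ [D j i] := by
  simp [key]

theorem key_append_single_iff_rank_pair {m n : ℕ} (hm : 1 ≤ m)
    (D : Fin m → Fin n → ℝ) (s : List (Fin n)) (i : Fin n) (j k : Fin m) :
    (List.Lex (· < ·) (key D (s ++ [i]) j) (key D (s ++ [i]) k) ↔
      rk D s j < rk D s k ∨ (rk D s j = rk D s k ∧ D j i < D k i)) ∧
    (key D (s ++ [i]) j = key D (s ++ [i]) k ↔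
      rk D s j = rk D s k ∧ D j i = D k i) := by
  rw [rk_lt_rk_iff, rk_eq_rk_iff]
  simp only [key_append_singleton]
  refine ⟨List.lex_append_singleton_iff (by simp [key]) _ _, ?_⟩
  rw [← List.concat_eq_append, ← List.concat_eq_append, List.concat_inj]
end

section
/- For all lists of columns s t : List (Fin n) and all rows j k : Fin m, if rk_s(j) < rk_s(k) then rk_{s++t}(j) < rk_{s++t}(k); equivalently, rk_{s++t}(j) ≤ rk_{s++t}(k) implies rk_s(j) ≤ rk_s(k). That is, the rank function of the lexicographical sorting by s++t is a refinement of the rank function of the lexicographical sorting by s. -/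
open scoped Classical

theorem List.Lex.append_of_length_eq {α : Type*} {r : α → α → Prop} {l₁ l₂ : List α}
    (h : List.Lex r l₁ l₂) (hlen : l₁.length = l₂.length) (t₁ t₂ : List α) :
    List.Lex r (l₁ ++ t₁) (l₂ ++ t₂) := by
  induction h with
  | nil => simp at hlen
  | rel h => exact .rel h
  | cons _ ih => exact .cons (ih (by simpa using hlen))

theorem Finset.card_filter_lt_lt_iff {α : Type*} [LinearOrder α] {S : Finset α} {a b : α}
    (ha : a ∈ S) : (S.filter (· < a)).card < (S.filter (· < b)).card ↔ a < b := by
  refine ⟨fun h => ?_, fun h => Finset.card_lt_card ?_⟩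
  · by_contra! hba
    exact h.not_ge (Finset.card_le_card
      (Finset.monotone_filter_right S fun _ _ hx => lt_of_lt_of_le hx hba))
  · rw [Finset.ssubset_iff_of_subset
      (Finset.monotone_filter_right S fun _ _ hx => lt_trans hx h)]
    exact ⟨a, by simp [ha, h]⟩

theorem rk_append_lt_rk_append {m n : ℕ} (D : Fin m → Fin n → ℝ) (s t : List (Fin n))
    {j k : Fin m} (h : rk D s j < rk D s k) : rk D (s ++ t) j < rk D (s ++ t) k := by
  rw [rk_lt_rk_iff] at h ⊢
  simpa [key] using h.append_of_length_eq (by simp [key]) (key D t j) (key D t k)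

theorem rk_append_refines {m n : ℕ} (hm : 1 ≤ m)
    (D : Fin m → Fin n → ℝ) (s t : List (Fin n)) (j k : Fin m) :
    (rk D s j < rk D s k → rk D (s ++ t) j < rk D (s ++ t) k) ∧
    (rk D (s ++ t) j ≤ rk D (s ++ t) k → rk D s j ≤ rk D s k) := by
  exact ⟨rk_append_lt_rk_append D s t,
    fun h => not_lt.mp fun hlt => h.not_gt (rk_append_lt_rk_append D s t hlt)⟩
end

section
/- For every function L : Fin m → ℕ, every column i : Fin n, and all rows j k : Fin m, if L(j) < L(k) then Refine(L,i)(j) < Refine(L,i)(k). -/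
open scoped Classical

/-- `subID D L i j` is the number of distinct reals in
`{D k i | L k = L j and D k i < D j i}`. -/
noncomputable def subID {m n : ℕ} (D : Fin m → Fin n → ℝ) (L : Fin m → ℕ) (i : Fin n)
    (j : Fin m) : ℕ :=
  ((Finset.univ.filter (fun k => L k = L j ∧ D k i < D j i)).image (fun k => D k i)).card

/-- `newCount D L i r` is one less than the number of distinct reals in
`{D k i | L k = r}` if `{k | L k = r}` is nonempty, and `0` otherwise. -/
noncomputable def newCount {m n : ℕ} (D : Fin m → Fin n → ℝ) (L : Fin m → ℕ) (i : Fin n)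
    (r : ℕ) : ℕ :=
  if (Finset.univ.filter (fun k => L k = r)).Nonempty then
    ((Finset.univ.filter (fun k => L k = r)).image (fun k => D k i)).card - 1
  else 0

/-- `numNewID D L i r = ∑_{l=0}^{r-1} newCount D L i l`. -/
noncomputable def numNewID {m n : ℕ} (D : Fin m → Fin n → ℝ) (L : Fin m → ℕ) (i : Fin n)
    (r : ℕ) : ℕ :=
  ∑ l ∈ Finset.range r, newCount D L i l

/-- The refinement of a ranking `L` by column `i`. -/
noncomputable def Refine {m n : ℕ} (D : Fin m → Fin n → ℝ) (L : Fin m → ℕ) (i : Fin n)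
    (j : Fin m) : ℕ :=
  L j + numNewID D L i (L j) + subID D L i j

/-- The rank of a row within its class is at most `newCount` of that class. -/
theorem subID_le_newCount {m n : ℕ} (D : Fin m → Fin n → ℝ) (L : Fin m → ℕ) (i : Fin n)
    (j : Fin m) : subID D L i j ≤ newCount D L i (L j) := by
  have hne : (Finset.univ.filter (fun k => L k = L j)).Nonempty := ⟨j, by simp⟩
  rw [newCount, if_pos hne, subID]
  refine Nat.le_sub_one_of_lt (Finset.card_lt_card ?_)
  rw [Finset.ssubset_iff_of_subset]
  · refine ⟨D j i, Finset.mem_image_of_mem _ (by simp), ?_⟩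
    simp only [Finset.mem_image, Finset.mem_filter, Finset.mem_univ, true_and]
    rintro ⟨k, ⟨-, hlt⟩, heq⟩
    exact hlt.ne heq
  · apply Finset.image_subset_image
    intro k hk
    simp only [Finset.mem_filter, Finset.mem_univ, true_and] at hk ⊢
    exact hk.1

/-- `numNewID` jumps by at least `newCount` of each smaller class. -/
theorem numNewID_add_newCount_le {m n : ℕ} (D : Fin m → Fin n → ℝ) (L : Fin m → ℕ)
    (i : Fin n) {r s : ℕ} (h : r < s) :
    numNewID D L i r + newCount D L i r ≤ numNewID D L i s := by
  rw [numNewID, numNewID, ← Finset.sum_range_succ]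
  exact Finset.sum_le_sum_of_subset (Finset.range_mono h)

theorem refine_strictMono_on_ranks {m n : ℕ} (hm : 1 ≤ m)
    (D : Fin m → Fin n → ℝ) (L : Fin m → ℕ) (i : Fin n) (j k : Fin m)
    (h : L j < L k) :
    Refine D L i j < Refine D L i k := by
  have hsub := subID_le_newCount D L i j
  have hnum := numNewID_add_newCount_le D L i h
  unfold Refine
  omega
end

section
/- For every function L : Fin m → ℕ, every column i : Fin n, and all rows j k : Fin m with L(j) = L(k): D j i < D k i if and only if Refine(L,i)(j) < Refine(L,i)(k), and D j i = D k i if and only if Refine(L,i)(j) = Refine(L,i)(k). -/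
open scoped Classical

theorem subID_lt_subID {m n : ℕ} {D : Fin m → Fin n → ℝ} {L : Fin m → ℕ} {i : Fin n}
    {j k : Fin m} (h : L j = L k) (hlt : D j i < D k i) :
    subID D L i j < subID D L i k := by
  unfold subID
  refine Finset.card_lt_card (Finset.ssubset_iff_of_subset ?_ |>.2 ⟨D j i, ?_, ?_⟩)
  · refine Finset.image_subset_image fun l hl => ?_
    simp only [Finset.mem_filter, Finset.mem_univ, true_and] at hl ⊢
    exact ⟨hl.1.trans h, hl.2.trans hlt⟩
  · exact Finset.mem_image.2 ⟨j, by simp [h, hlt], rfl⟩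
  · simp only [Finset.mem_image, Finset.mem_filter, Finset.mem_univ, true_and]
    rintro ⟨l, hl, e⟩
    exact hl.2.ne e

theorem refine_lt_refine {m n : ℕ} {D : Fin m → Fin n → ℝ} {L : Fin m → ℕ} {i : Fin n}
    {j k : Fin m} (h : L j = L k) (hlt : D j i < D k i) :
    Refine D L i j < Refine D L i k := by
  unfold Refine
  rw [h]
  exact Nat.add_lt_add_left (subID_lt_subID h hlt) _

theorem refine_eq_refine {m n : ℕ} {D : Fin m → Fin n → ℝ} {L : Fin m → ℕ} {i : Fin n}
    {j k : Fin m} (h : L j = L k) (heq : D j i = D k i) :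
    Refine D L i j = Refine D L i k := by
  simp only [Refine, subID, h, heq]

theorem refine_orders_within_block {m n : ℕ} (hm : 1 ≤ m)
    (D : Fin m → Fin n → ℝ) (L : Fin m → ℕ) (i : Fin n) (j k : Fin m)
    (h : L j = L k) :
    (D j i < D k i ↔ Refine D L i j < Refine D L i k) ∧
    (D j i = D k i ↔ Refine D L i j = Refine D L i k) := by
  rcases lt_trichotomy (D j i) (D k i) with hd | hd | hd
  · have hr := refine_lt_refine h hd
    exact ⟨iff_of_true hd hr, iff_of_false hd.ne hr.ne⟩
  · have hr := refine_eq_refine h hd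
    exact ⟨iff_of_false hd.not_lt hr.not_lt, iff_of_true hd hr⟩
  · have hr := refine_lt_refine h.symm hd
    exact ⟨iff_of_false hd.not_gt hr.not_gt, iff_of_false hd.ne' hr.ne'⟩
end

section
/- Correctness of lexicographic sorting by iterated stable sorting (StableLexSort): for every list of columns s : List (Fin n), the list of row indices List.foldr (fun a l => l.mergeSort (fun j k => D j a ≤ D k a)) (List.finRange m) s — i.e., starting from the list of all rows and successively stable-sorting by the columns of s from the last (least important) column to the first (most important) column, using the stable sort List.mergeSort — is a permutation of List.finRange m and satisfies List.Pairwise (fun j k => key_s(j) ≤lex key_s(k)); that is, it lists the rows of D in lexicographically nondecreasing order with respect to the sequence of columns s. -/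
open scoped Classical

/-- Stable sorting preserves any pairwise relation among elements that compare equal. -/
theorem List.Pairwise.mergeSort_stable {α : Type*} {le : α → α → Bool} {R : α → α → Prop}
    {l : List α} (trans : ∀ a b c : α, le a b → le b c → le a c)
    (total : ∀ a b : α, le a b || le b a) (h : l.Pairwise R) :
    (l.mergeSort le).Pairwise (fun a b => le a b ∧ (le b a → R a b)) := by
  refine List.pairwise_iff_forall_sublist.2 fun {a b} hab => ?_
  have le_ab : le a b := List.pairwise_iff_forall_sublist.1
    (List.pairwise_mergeSort trans total l) hab
  refine ⟨le_ab, fun le_ba => List.pairwise_iff_forall_sublist.1 h ?_⟩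
  have le_aa : le a a := by simpa using total a a
  let p : α → Bool := fun x => le x a && le a x
  have hp : (l.filter p).Pairwise (fun x y => le x y) := by
    refine List.pairwise_of_forall_mem_list fun x hx y hy => ?_
    simp only [List.mem_filter, p, Bool.and_eq_true] at hx hy
    exact trans x a y hx.2.1 hy.2.2
  have hsub : (l.filter p).Sublist ((l.mergeSort le).filter p) := by
    simpa using (List.sublist_mergeSort trans total hp List.filter_sublist).filter p
  have heq : l.filter p = (l.mergeSort le).filter p :=
    hsub.eq_of_length ((List.mergeSort_perm l le).filter p).length_eq.symm
  have hf : [a, b].Sublist ((l.mergeSort le).filter p) := by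
    simpa [p, le_aa, le_ab, le_ba] using hab.filter p
  exact (heq ▸ hf).trans List.filter_sublist

/-- correctness of StableLexSort (iterated stable `mergeSort`,
from the least important column to the most important one). -/
theorem stableLexSort_correct {m n : ℕ} (hm : 1 ≤ m)
    (D : Fin m → Fin n → ℝ) (s : List (Fin n)) :
    (List.foldr (fun a l => l.mergeSort (fun j k => D j a ≤ D k a))
        (List.finRange m) s).Perm (List.finRange m) ∧
    (List.foldr (fun a l => l.mergeSort (fun j k => D j a ≤ D k a))
        (List.finRange m) s).Pairwise
      (fun j k => List.Lex (· < ·) (key D s j) (key D s k) ∨ key D s j = key D s k) := by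
  induction s with
  | nil => exact ⟨List.Perm.refl _, List.pairwise_of_forall fun _ _ => Or.inr rfl⟩
  | cons a s ih =>
    refine ⟨(List.mergeSort_perm _ _).trans ih.1, ?_⟩
    refine (ih.2.mergeSort_stable ?_ ?_).imp ?_
    · simp only [decide_eq_true_eq]
      exact fun _ _ _ => le_trans
    · simp only [Bool.or_eq_true, decide_eq_true_eq]
      exact fun _ _ => le_total _ _
    · intro j k hjk
      simp only [decide_eq_true_eq] at hjk
      simp only [key, List.map_cons] at hjk ⊢
      rcases hjk.1.lt_or_eq with hlt | heq
      · exact Or.inl (List.Lex.rel hlt)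
      · rw [heq]
        exact (hjk.2 heq.ge).imp List.Lex.cons (congrArg _)
end

section
/- For every list of columns s : List (Fin n), every column i : Fin n, and every bijection O : Fin m → Fin m such that for all t t' : Fin m with t ≤ t' the pair (rk_s(O t), D (O t) i) is ≤ the pair (rk_s(O t'), D (O t') i) in the lexicographic order on ℕ × ℝ, the bijection O is an order vector for s++[i]: for all t ≤ t', key_{s++[i]}(O t) ≤lex key_{s++[i]}(O t'). -/
open scoped Classical

theorem lex_append_of_length_eq {α : Type*} {r : α → α → Prop} {l₁ l₂ : List α}
    (h : List.Lex r l₁ l₂) (hlen : l₁.length = l₂.length) (u v : List α) :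
    List.Lex r (l₁ ++ u) (l₂ ++ v) := by
  induction h with
  | nil => simp at hlen
  | rel hab => exact List.Lex.rel hab
  | cons _ ih => exact List.Lex.cons (ih (by simpa using hlen))

theorem rk_lt_rk_of_lex {m n : ℕ} {D : Fin m → Fin n → ℝ} {s : List (Fin n)} {j k : Fin m}
    (h : List.Lex (· < ·) (key D s j) (key D s k)) : rk D s j < rk D s k := by
  change key D s j < key D s k at h
  refine Finset.card_lt_card (Finset.ssubset_iff_of_subset ?_ |>.2 ⟨key D s j, ?_, ?_⟩)
  · intro v hv
    rw [Finset.mem_filter] at hv ⊢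
    exact ⟨hv.1, lt_trans (show v < key D s j from hv.2) h⟩
  · rw [Finset.mem_filter]
    exact ⟨Finset.mem_image_of_mem _ (Finset.mem_univ _), h⟩
  · rw [Finset.mem_filter]
    exact fun hv => lt_irrefl (key D s j) hv.2

theorem order_by_rank_pair_is_order_vector {m n : ℕ} (hm : 1 ≤ m)
    (D : Fin m → Fin n → ℝ) (s : List (Fin n)) (i : Fin n) (O : Fin m → Fin m)
    (hbij : Function.Bijective O)
    (hord : ∀ t t' : Fin m, t ≤ t' →
      (toLex (rk D s (O t), D (O t) i) : ℕ ×ₗ ℝ)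
        ≤ toLex (rk D s (O t'), D (O t') i)) :
    ∀ t t' : Fin m, t ≤ t' →
      List.Lex (· < ·) (key D (s ++ [i]) (O t)) (key D (s ++ [i]) (O t')) ∨
        key D (s ++ [i]) (O t) = key D (s ++ [i]) (O t') := by
  intro t t' htt'
  have happ (j : Fin m) : key D (s ++ [i]) j = key D s j ++ [D j i] := by simp [key]
  have hle := Prod.Lex.toLex_le_toLex.1 (hord t t' htt')
  rw [happ, happ]
  rcases lt_trichotomy (key D s (O t)) (key D s (O t')) with h | h | h
  · exact .inl (lex_append_of_length_eq h (by simp [key]) _ _)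
  · have hrk : rk D s (O t) = rk D s (O t') := by simp only [rk, h]
    rw [h]
    rcases hle with hlt | ⟨-, hD⟩
    · exact absurd hrk hlt.ne
    · rcases hD.lt_or_eq with hD | hD
      · exact .inl (List.Lex.append_left _ (.rel hD) _)
      · exact .inr (congrArg (fun x => key D s (O t') ++ [x]) hD)
  · have hrk := rk_lt_rk_of_lex h
    rcases hle with hlt | ⟨heq, -⟩
    · exact absurd hrk hlt.asymm
    · exact absurd heq hrk.ne'
end

section
/- For every list of columns s : List (Fin n) and every order vector O for s, defining the partitioning vector P(r) := the cardinality of {j : Fin m | rk_s(j) < r}, one has for every position t : Fin m and every r : ℕ: rk_s(O t) = r if and only if P(r) ≤ (t : ℕ) < P(r+1). Consequently, the rows of rank r are exactly O(P(r)), O(P(r)+1), …, O(P(r+1) − 1), and P(r+1) − P(r) equals the cardinality of {j : Fin m | rk_s(j) = r} (the size of the r-th block of the contingency table). -/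
open scoped Classical

/-- The sublevel sets of a monotone function on `Fin m` are initial segments. -/
theorem Monotone.lt_iff_val_lt_card_filter {m : ℕ} {α : Type*} [LinearOrder α] {f : Fin m → α}
    (hf : Monotone f) (t : Fin m) (a : α) :
    f t < a ↔ (t : ℕ) < (Finset.univ.filter (fun u => f u < a)).card := by
  constructor
  · intro h
    have hsub : Finset.Iic t ⊆ Finset.univ.filter (fun u => f u < a) := fun u hu => by
      simpa using (hf (Finset.mem_Iic.1 hu)).trans_lt h
    have := Finset.card_le_card hsub
    rw [Fin.card_Iic] at this
    omega
  · intro h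
    by_contra! hn
    have hsub : Finset.univ.filter (fun u => f u < a) ⊆ Finset.Iio t := fun u hu => by
      rw [Finset.mem_Iio]
      exact hf.reflect_lt (((Finset.mem_filter.1 hu).2).trans_le hn)
    have := Finset.card_le_card hsub
    rw [Fin.card_Iio] at this
    omega

theorem rk_le_rk_of_key_lex {m n : ℕ} (D : Fin m → Fin n → ℝ) (s : List (Fin n)) {j j' : Fin m}
    (h : List.Lex (· < ·) (key D s j) (key D s j') ∨ key D s j = key D s j') :
    rk D s j ≤ rk D s j' := by
  rcases h with h | h
  · refine Finset.card_le_card (Finset.monotone_filter_right _ fun v _ hv => ?_)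
    have h₁ : v < key D s j := hv
    have h₂ : key D s j < key D s j' := h
    exact h₁.trans h₂
  · rw [rk, rk, h]

theorem partitioning_vector_blocks {m n : ℕ} (hm : 1 ≤ m)
    (D : Fin m → Fin n → ℝ) (s : List (Fin n)) (O : Fin m → Fin m)
    (hbij : Function.Bijective O)
    (hord : ∀ t t' : Fin m, t ≤ t' →
      List.Lex (· < ·) (key D s (O t)) (key D s (O t')) ∨
        key D s (O t) = key D s (O t')) :
    (∀ (t : Fin m) (r : ℕ),
        rk D s (O t) = r ↔
          (Finset.univ.filter (fun j => rk D s j < r)).card ≤ (t : ℕ) ∧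
            (t : ℕ) < (Finset.univ.filter (fun j => rk D s j < r + 1)).card) ∧
    (∀ r : ℕ,
        (Finset.univ.filter (fun j => rk D s j < r + 1)).card
            - (Finset.univ.filter (fun j => rk D s j < r)).card
          = (Finset.univ.filter (fun j => rk D s j = r)).card) := by
  have hmono : Monotone fun t => rk D s (O t) := fun t t' h =>
    rk_le_rk_of_key_lex D s (hord t t' h)
  have hcard : ∀ r, (Finset.univ.filter (fun t => rk D s (O t) < r)).card =
      (Finset.univ.filter (fun j => rk D s j < r)).card := fun r =>
    Finset.card_bijective O hbij (by simp)
  have hlt : ∀ (t : Fin m) (r : ℕ), rk D s (O t) < r ↔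
      (t : ℕ) < (Finset.univ.filter (fun j => rk D s j < r)).card := fun t r => by
    rw [← hcard]
    exact hmono.lt_iff_val_lt_card_filter t r
  refine ⟨fun t r => ?_, fun r => ?_⟩
  · rw [← hlt, ← not_lt, ← hlt]
    omega
  · have hsub : Finset.univ.filter (fun j => rk D s j < r) ⊆
        Finset.univ.filter (fun j => rk D s j < r + 1) :=
      Finset.monotone_filter_right _ fun j _ h => Nat.lt_succ_of_lt h
    rw [← Finset.card_sdiff_of_subset hsub]
    congr 1
    ext j
    simp only [Finset.mem_sdiff, Finset.mem_filter, Finset.mem_univ, true_and]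
    omega
end

section
/- For every list of columns s : List (Fin n) and every order vector O for s: rk_s(O 0) = 0; for every t : Fin m with (t : ℕ) + 1 < m, rk_s(O (t+1)) equals rk_s(O t) or rk_s(O t) + 1; and consequently the map t ↦ rk_s(O t) is nondecreasing and satisfies rk_s(O t) ≤ (t : ℕ) for every t : Fin m. -/
open scoped Classical

theorem key_lex_iff_lt (v w : List ℝ) : List.Lex (· < ·) v w ↔ v < w := Iff.rfl

theorem mem_filter_key_iff {m n : ℕ} (D : Fin m → Fin n → ℝ) (s : List (Fin n)) (j : Fin m)
    (v : List ℝ) :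
    v ∈ (Finset.univ.image (key D s)).filter (fun v => List.Lex (· < ·) v (key D s j)) ↔
      (∃ i, key D s i = v) ∧ v < key D s j := by
  rw [Finset.mem_filter, key_lex_iff_lt]
  simp

theorem rk_mono {m n : ℕ} (D : Fin m → Fin n → ℝ) (s : List (Fin n)) {i j : Fin m}
    (h : key D s i ≤ key D s j) : rk D s i ≤ rk D s j := by
  refine Finset.card_le_card fun v hv => ?_
  rw [mem_filter_key_iff] at hv ⊢
  exact ⟨hv.1, hv.2.trans_le h⟩

theorem rk_eq_zero_of_forall_key_le {m n : ℕ} (D : Fin m → Fin n → ℝ) (s : List (Fin n))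
    {j : Fin m} (h : ∀ i, key D s j ≤ key D s i) : rk D s j = 0 := by
  refine Finset.card_eq_zero.mpr (Finset.eq_empty_of_forall_notMem fun v hv => ?_)
  obtain ⟨⟨i, rfl⟩, hlt⟩ := (mem_filter_key_iff D s j v).mp hv
  exact (h i).not_gt hlt

/-- If no key lies strictly between the keys of two rows, their ranks differ by one. -/
theorem rk_eq_add_one {m n : ℕ} (D : Fin m → Fin n → ℝ) (s : List (Fin n)) {i j : Fin m}
    (hij : key D s i < key D s j) (h : ∀ k, key D s k ≤ key D s i ∨ key D s j ≤ key D s k) :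
    rk D s j = rk D s i + 1 := by
  have hnot : key D s i ∉ (Finset.univ.image (key D s)).filter
      (fun v => List.Lex (· < ·) v (key D s i)) := fun hv =>
    lt_irrefl _ ((mem_filter_key_iff D s i _).mp hv).2
  rw [rk, rk, ← Finset.card_insert_of_notMem hnot]
  congr 1
  ext v
  rw [Finset.mem_insert, mem_filter_key_iff, mem_filter_key_iff]
  constructor
  · rintro ⟨⟨k, rfl⟩, hk⟩
    rcases ((h k).resolve_right hk.not_ge).eq_or_lt with he | hlt
    · exact Or.inl he
    · exact Or.inr ⟨⟨k, rfl⟩, hlt⟩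
  · rintro (rfl | ⟨hk, hlt⟩)
    · exact ⟨⟨i, rfl⟩, hij⟩
    · exact ⟨hk, hlt.trans hij⟩

theorem rank_along_order_vector {m n : ℕ} (hm : 1 ≤ m)
    (D : Fin m → Fin n → ℝ) (s : List (Fin n)) (O : Fin m → Fin m)
    (hbij : Function.Bijective O)
    (hord : ∀ t t' : Fin m, t ≤ t' →
      List.Lex (· < ·) (key D s (O t)) (key D s (O t')) ∨
        key D s (O t) = key D s (O t')) :
    rk D s (O ⟨0, hm⟩) = 0 ∧
    (∀ (t : Fin m) (h : (t : ℕ) + 1 < m),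
        rk D s (O ⟨(t : ℕ) + 1, h⟩) = rk D s (O t) ∨
          rk D s (O ⟨(t : ℕ) + 1, h⟩) = rk D s (O t) + 1) ∧
    (∀ t t' : Fin m, t ≤ t' → rk D s (O t) ≤ rk D s (O t')) ∧
    (∀ t : Fin m, rk D s (O t) ≤ (t : ℕ)) := by
  have hmono : Monotone fun t => key D s (O t) := fun t t' h =>
    le_iff_lt_or_eq.mpr (hord t t' h)
  have hzero : rk D s (O ⟨0, hm⟩) = 0 := by
    refine rk_eq_zero_of_forall_key_le D s fun i => ?_
    obtain ⟨t, rfl⟩ := hbij.surjective i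
    exact hmono (Fin.mk_le_of_le_val t.val.zero_le)
  have hstep : ∀ (t : Fin m) (h : (t : ℕ) + 1 < m),
      rk D s (O ⟨(t : ℕ) + 1, h⟩) = rk D s (O t) ∨
        rk D s (O ⟨(t : ℕ) + 1, h⟩) = rk D s (O t) + 1 := by
    intro t h
    rcases hord t ⟨(t : ℕ) + 1, h⟩ (Fin.le_def.mpr (Nat.le_succ _)) with hlt | heq
    · refine Or.inr (rk_eq_add_one D s hlt fun k => ?_)
      obtain ⟨u, rfl⟩ := hbij.surjective k
      rcases le_or_gt u t with hu | hu
      · exact Or.inl (hmono hu)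
      · exact Or.inr (hmono (Fin.mk_le_of_le_val hu))
    · exact Or.inl (le_antisymm (rk_mono D s heq.ge) (rk_mono D s heq.le))
  refine ⟨hzero, hstep, fun t t' h => rk_mono D s (hmono h), ?_⟩
  rintro ⟨t, ht⟩
  induction t with
  | zero => exact hzero.le
  | succ t ih =>
    have hle := ih (Nat.lt_of_succ_lt ht)
    have hs := hstep ⟨t, Nat.lt_of_succ_lt ht⟩ ht
    dsimp only at hle hs ⊢
    omega
end
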